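/- Let k be a field, A a Hopf algebra over k, and f_1, f_2, f_3 ∈ Hom_k(A,k) primitive elements. Define the k-linear functional λ : A^{⊗4} → k by λ(a_0 ⊗ a_1 ⊗ a_2 ⊗ a_3) := ε( a_0 (f_1⊳a_1)(f_2⊳a_2)(f_3⊳a_3) ). Then λ vanishes on the image of the Hochschild boundary b_4 : A^{⊗5} → A^{⊗4}, i.e. λ ∘ b_4 = 0. -/

import Mathlib

open TensorProduct

noncomputable section

variable (k A : Type*) [Field k] [Ring A] [HopfAlgebra k A]

/-- Multiply the first two tensor factors of `A ⊗ (A ⊗ M)`. -/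
def mulFirst (M : Type*) [AddCommGroup M] [Module k M] :
    A ⊗[k] (A ⊗[k] M) →ₗ[k] A ⊗[k] M :=
  (TensorProduct.map (LinearMap.mul' k A) LinearMap.id) ∘ₗ
    (TensorProduct.assoc k A A M).symm.toLinearMap

/-- `A^{⊗3} ≃ A^{⊗2} ⊗ A`, pulling the last factor out. -/
def pull3 : A ⊗[k] (A ⊗[k] A) ≃ₗ[k] (A ⊗[k] A) ⊗[k] A :=
  (TensorProduct.assoc k A A A).symm

/-- `A^{⊗4} ≃ A^{⊗3} ⊗ A`, pulling the last factor out. -/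
def pull4 : A ⊗[k] (A ⊗[k] (A ⊗[k] A)) ≃ₗ[k] (A ⊗[k] (A ⊗[k] A)) ⊗[k] A :=
  (TensorProduct.congr (LinearEquiv.refl k A) (pull3 k A)).trans
    (TensorProduct.assoc k A (A ⊗[k] A) A).symm

/-- `A^{⊗5} ≃ A^{⊗4} ⊗ A`, pulling the last factor out. -/
def pull5 : A ⊗[k] (A ⊗[k] (A ⊗[k] (A ⊗[k] A)))
    ≃ₗ[k] (A ⊗[k] (A ⊗[k] (A ⊗[k] A))) ⊗[k] A :=
  (TensorProduct.congr (LinearEquiv.refl k A) (pull4 k A)).trans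
    (TensorProduct.assoc k A (A ⊗[k] (A ⊗[k] A)) A).symm

/-- Cyclic rotation `a₀ ⊗ ⋯ ⊗ a₄ ↦ a₄ ⊗ a₀ ⊗ ⋯ ⊗ a₃` of `A^{⊗5}`. -/
def rotate5 : A ⊗[k] (A ⊗[k] (A ⊗[k] (A ⊗[k] A)))
    ≃ₗ[k] A ⊗[k] (A ⊗[k] (A ⊗[k] (A ⊗[k] A))) :=
  (pull5 k A).trans (TensorProduct.comm k (A ⊗[k] (A ⊗[k] (A ⊗[k] A))) A)

/-- The Hochschild boundary `b₄ : A^{⊗5} → A^{⊗4}`,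
`a₀⊗⋯⊗a₄ ↦ a₀a₁⊗a₂⊗a₃⊗a₄ - a₀⊗a₁a₂⊗a₃⊗a₄ + a₀⊗a₁⊗a₂a₃⊗a₄ - a₀⊗a₁⊗a₂⊗a₃a₄
             + a₄a₀⊗a₁⊗a₂⊗a₃`. -/
def hochschildB4 : A ⊗[k] (A ⊗[k] (A ⊗[k] (A ⊗[k] A)))
    →ₗ[k] A ⊗[k] (A ⊗[k] (A ⊗[k] A)) :=
  mulFirst k A (A ⊗[k] (A ⊗[k] A))
  + (-1 : k) • TensorProduct.map (LinearMap.id : A →ₗ[k] A) (mulFirst k A (A ⊗[k] A))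
  + TensorProduct.map (LinearMap.id : A →ₗ[k] A)
      (TensorProduct.map (LinearMap.id : A →ₗ[k] A) (mulFirst k A A))
  + (-1 : k) • TensorProduct.map (LinearMap.id : A →ₗ[k] A)
      (TensorProduct.map (LinearMap.id : A →ₗ[k] A)
        (TensorProduct.map (LinearMap.id : A →ₗ[k] A) (LinearMap.mul' k A)))
  + (mulFirst k A (A ⊗[k] (A ⊗[k] A))) ∘ₗ (rotate5 k A).toLinearMap

/-- Multiplication `A^{⊗3} → A`, `a₀ ⊗ a₁ ⊗ a₂ ↦ a₀a₁a₂`. -/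
def mult3 : A ⊗[k] (A ⊗[k] A) →ₗ[k] A :=
  (LinearMap.mul' k A) ∘ₗ TensorProduct.map (LinearMap.id : A →ₗ[k] A) (LinearMap.mul' k A)

/-- Multiplication `A^{⊗4} → A`, `a₀ ⊗ a₁ ⊗ a₂ ⊗ a₃ ↦ a₀a₁a₂a₃`. -/
def mult4 : A ⊗[k] (A ⊗[k] (A ⊗[k] A)) →ₗ[k] A :=
  (LinearMap.mul' k A) ∘ₗ TensorProduct.map (LinearMap.id : A →ₗ[k] A) (mult3 k A)

/-- The left action of a functional `f ∈ Hom_k(A,k)` on `A`: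
`f ⊳ a := a₍₁₎ f(a₍₂₎) = ((id_A ⊗ f) ∘ Δ)(a)`. -/
def functionalAct (f : A →ₗ[k] k) : A →ₗ[k] A :=
  (TensorProduct.rid k A).toLinearMap ∘ₗ
    (TensorProduct.map LinearMap.id f) ∘ₗ (Coalgebra.comul (R := k))

/-- A linear functional `f : A → k` is primitive if
`f(ab) = ε(a) f(b) + f(a) ε(b)` for all `a, b ∈ A`. -/
def IsPrimitiveFunctional (f : A →ₗ[k] k) : Prop :=
  ∀ a b : A, f (a * b) =
    Coalgebra.counit (R := k) a * f b + f a * Coalgebra.counit (R := k) b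

/-- The functional `λ : A^{⊗4} → k`,
`a₀ ⊗ a₁ ⊗ a₂ ⊗ a₃ ↦ ε(a₀ (f₁⊳a₁) (f₂⊳a₂) (f₃⊳a₃))`. -/
def capFunctional (f₁ f₂ f₃ : A →ₗ[k] k) :
    A ⊗[k] (A ⊗[k] (A ⊗[k] A)) →ₗ[k] k :=
  (Coalgebra.counit (R := k)) ∘ₗ (mult4 k A) ∘ₗ
    TensorProduct.map (LinearMap.id : A →ₗ[k] A)
      (TensorProduct.map (functionalAct k A f₁)
        (TensorProduct.map (functionalAct k A f₂) (functionalAct k A f₃)))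

/-- The counit recovers a functional from its action: `ε(f ⊳ a) = f(a)`. -/
theorem counit_functionalAct (f : A →ₗ[k] k) (a : A) :
    Coalgebra.counit (R := k) (functionalAct k A f a) = f a := by
  have key : (Coalgebra.counit (R := k) (A := A)) ∘ₗ (TensorProduct.rid k A).toLinearMap ∘ₗ
      TensorProduct.map LinearMap.id f =
      f ∘ₗ (TensorProduct.lid k A).toLinearMap ∘ₗ
        (Coalgebra.counit (R := k) (A := A)).rTensor A := by
    ext x y
    simp [mul_comm]
  have h := LinearMap.congr_fun key (Coalgebra.comul (R := k) a)
  simpa [functionalAct, Coalgebra.rTensor_counit_comul a] using h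

/-- `λ(a ⊗ b ⊗ c ⊗ d) = ε(a) f₁(b) f₂(c) f₃(d)`. -/
theorem capFunctional_tmul (f₁ f₂ f₃ : A →ₗ[k] k) (a b c d : A) :
    capFunctional k A f₁ f₂ f₃ (a ⊗ₜ (b ⊗ₜ (c ⊗ₜ d))) =
      Coalgebra.counit (R := k) a * (f₁ b * (f₂ c * f₃ d)) := by
  simp [capFunctional, mult4, mult3, counit_functionalAct]

/-- The Hochschild boundary `b₄` on pure tensors. -/
theorem hochschildB4_tmul (a b c d e : A) :
    hochschildB4 k A (a ⊗ₜ (b ⊗ₜ (c ⊗ₜ (d ⊗ₜ e)))) =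
      (a * b) ⊗ₜ[k] (c ⊗ₜ[k] (d ⊗ₜ[k] e)) - a ⊗ₜ[k] ((b * c) ⊗ₜ[k] (d ⊗ₜ[k] e))
        + a ⊗ₜ[k] (b ⊗ₜ[k] ((c * d) ⊗ₜ[k] e)) - a ⊗ₜ[k] (b ⊗ₜ[k] (c ⊗ₜ[k] (d * e)))
        + (e * a) ⊗ₜ[k] (b ⊗ₜ[k] (c ⊗ₜ[k] d)) := by
  simp [hochschildB4, mulFirst, rotate5, pull5, pull4, pull3, sub_eq_add_neg]

/-- for primitive functionals `f₁, f₂, f₃` on a Hopf algebra `A`, the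
functional `λ(a₀⊗a₁⊗a₂⊗a₃) = ε(a₀ (f₁⊳a₁)(f₂⊳a₂)(f₃⊳a₃))` vanishes on the image of the
Hochschild boundary `b₄ : A^{⊗5} → A^{⊗4}`, i.e. `λ ∘ b₄ = 0`. -/
theorem capFunctional_comp_hochschildB4_eq_zero
    (f₁ f₂ f₃ : A →ₗ[k] k)
    (hf₁ : IsPrimitiveFunctional k A f₁) (hf₂ : IsPrimitiveFunctional k A f₂)
    (hf₃ : IsPrimitiveFunctional k A f₃) :
    (capFunctional k A f₁ f₂ f₃) ∘ₗ (hochschildB4 k A) = 0 := by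
  ext a b c d e
  simp only [TensorProduct.AlgebraTensorModule.curry_apply, TensorProduct.curry_apply,
    LinearMap.restrictScalars_self, LinearMap.comp_apply,
    LinearMap.zero_apply, hochschildB4_tmul, map_add, map_sub,
    capFunctional_tmul, hf₁ b c, hf₂ c d, hf₃ d e, Bialgebra.counit_mul]
  ring

end
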